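/- arXiv:2502.10981 — 2 statements merged into one kernel-verified Lean document; each statement's English description precedes it below -/
import Mathlib

section
/- Let G be a finite simple bipartite graph on n vertices that admits an involutory weighted adjacency matrix over some field F. Then the minimum forcing number of the prism over G satisfies f(G □ K_2) = n/2. -/
open SimpleGraph

noncomputable def forcingNumber {V : Type*} (G : SimpleGraph V) (M : G.Subgraph) : ℕ :=
  sInf {c | ∃ S : Set (Sym2 V), S ⊆ M.edgeSet ∧ S.ncard = c ∧
    ∀ M' : G.Subgraph, M'.IsPerfectMatching → S ⊆ M'.edgeSet → M' = M}

noncomputable def minForcingNumber {V : Type*} (G : SimpleGraph V) : ℕ :=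
  sInf {c | ∃ M : G.Subgraph, M.IsPerfectMatching ∧ forcingNumber G M = c}

/-- If a permutation `σ` supported on the nonzero pattern of `N` is determined by its restriction
to `T`, then `N` has rank at least `|V| - |T|`. -/
theorem Matrix.card_le_rank_add_card_of_forced {V F : Type*} [Fintype V] [DecidableEq V] [Field F]
    (N : Matrix V V F) (T : Finset V) (σ : Equiv.Perm V) (hσ : ∀ v, N v (σ v) ≠ 0)
    (h : ∀ τ : Equiv.Perm V, (∀ v, N v (τ v) ≠ 0) → (∀ v ∈ T, τ v = σ v) → τ = σ) :
    Fintype.card V ≤ N.rank + T.card := by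
  let K : Matrix {v // v ∉ T} {v // v ∉ T} F :=
    N.submatrix Subtype.val (fun w => σ w.1)
  have hdet : K.transpose.det ≠ 0 := by
    rw [Matrix.det_apply', Finset.sum_eq_single 1]
    · simpa [Finset.prod_ne_zero_iff, K] using fun v _ => hσ v
    · intro τ _ hτ
      by_contra h0
      have h1 := Finset.prod_ne_zero_iff.mp (right_ne_zero_of_mul h0)
      have h2 := h (σ * Equiv.Perm.ofSubtype τ) ?_ ?_
      · have h3 : Equiv.Perm.ofSubtype τ = 1 := by simpa using h2
        exact hτ (Equiv.Perm.ofSubtype_injective (by simpa using h3))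
      · intro v
        by_cases hv : v ∈ T
        · simpa [Equiv.Perm.ofSubtype_apply_of_not_mem τ (not_not.mpr hv)] using hσ v
        · simpa [Equiv.Perm.ofSubtype_apply_of_mem τ hv, K] using h1 ⟨v, hv⟩ (Finset.mem_univ _)
      · intro v hv
        simp [Equiv.Perm.ofSubtype_apply_of_not_mem τ (not_not.mpr hv)]
    · simp
  rw [Matrix.det_transpose] at hdet
  have hK : K.rank = Fintype.card {v // v ∉ T} :=
    Matrix.rank_of_isUnit K ((Matrix.isUnit_iff_isUnit_det K).mpr hdet.isUnit)
  have hle : K.rank ≤ N.rank := Matrix.rank_submatrix_le N _ _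
  have hcard : Fintype.card {v // v ∉ T} = Fintype.card V - T.card := by
    rw [Fintype.card_subtype_compl, Fintype.card_coe]
  omega

theorem Matrix.two_mul_rank_add_one_le {V F : Type*} [Fintype V] [DecidableEq V] [Field F]
    (A : Matrix V V F) (c : V → Fin 2) (hc : ∀ u v, A u v ≠ 0 → c u ≠ c v) (hinv : A * A = 1) :
    2 * (A + 1).rank ≤ Fintype.card V := by
  let d : V → F := fun v => if c v = 0 then 1 else -1
  have hd : ∀ v, d v * d v = 1 := fun v => by simp only [d]; split_ifs <;> simp
  have hD : IsUnit (Matrix.diagonal d).det := by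
    rw [Matrix.det_diagonal, isUnit_iff_ne_zero, Finset.prod_ne_zero_iff]
    exact fun v _ h0 => by simpa [h0] using hd v
  have hconj : Matrix.diagonal d * (A + 1) * Matrix.diagonal d = 1 - A := by
    ext u v
    rw [Matrix.mul_diagonal, Matrix.diagonal_mul]
    by_cases huv : u = v
    · subst huv
      have h0 : A u u = 0 := by
        by_contra h; exact hc u u h rfl
      simp [h0, hd]
    · by_cases h0 : A u v = 0
      · simp [h0, huv]
      · have h1 := hc u v h0
        have h2 : d u * d v = -1 := by
          simp only [d]
          split_ifs with h3 h4 h4 <;> first | omega | simp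
        have h3 : d u * A u v * d v = -A u v := by
          rw [mul_right_comm, h2, neg_one_mul]
        simp [huv, h3]
  have hrank : (1 - A).rank = (A + 1).rank := by
    rw [← hconj, Matrix.rank_mul_eq_left_of_isUnit_det _ _ hD,
      Matrix.rank_mul_eq_right_of_isUnit_det _ _ hD]
  have hmul : (A + 1) * (1 - A) = 0 := by
    rw [Matrix.add_mul, Matrix.mul_sub, hinv]; simp
  have := Matrix.rank_add_rank_le_card_of_mul_eq_zero hmul
  omega

/-- The vertex of the fibre over `v` in the first colour class of the prism, for a 2-colouring `c`
of the base graph. -/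
def prismLeft {V : Type*} (c : V → Fin 2) (v : V) : V × Fin 2 := (v, c v)

/-- The vertex of the fibre over `v` in the second colour class of the prism. -/
def prismRight {V : Type*} (c : V → Fin 2) (v : V) : V × Fin 2 := (v, c v + 1)

section Prism

variable {V : Type*} {c : V → Fin 2}

theorem eq_prismLeft_or_eq_prismRight (c : V → Fin 2) (a : V × Fin 2) :
    (∃ v, a = prismLeft c v) ∨ ∃ v, a = prismRight c v := by
  obtain ⟨v, i⟩ := a
  by_cases h : i = c v
  · exact .inl ⟨v, by simp [prismLeft, h]⟩
  · exact .inr ⟨v, by simp only [prismRight, Prod.mk.injEq, true_and]; omega⟩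

theorem prismLeft_injective : Function.Injective (prismLeft c) :=
  fun _ _ h => congrArg Prod.fst h

theorem prismRight_injective : Function.Injective (prismRight c) :=
  fun _ _ h => congrArg Prod.fst h

theorem prismLeft_ne_prismRight (v w : V) : prismLeft c v ≠ prismRight c w := by
  intro h
  simp only [prismLeft, prismRight, Prod.mk.injEq] at h
  obtain ⟨rfl, h⟩ := h
  omega

variable {G : SimpleGraph V} (hc : ∀ u v, G.Adj u v → c u ≠ c v)

include hc

theorem prism_adj_left_right (v w : V) :
    (G □ (⊤ : SimpleGraph (Fin 2))).Adj (prismLeft c v) (prismRight c w) ↔ v = w ∨ G.Adj v w := by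
  simp only [boxProd_adj, prismLeft, prismRight, top_adj]
  constructor
  · rintro (⟨h, -⟩ | ⟨-, h⟩)
    · exact .inr h
    · exact .inl h
  · rintro (rfl | h)
    · exact .inr ⟨by omega, rfl⟩
    · exact .inl ⟨h, by have := hc v w h; omega⟩

theorem not_prism_adj_left_left (v w : V) :
    ¬ (G □ (⊤ : SimpleGraph (Fin 2))).Adj (prismLeft c v) (prismLeft c w) := by
  simp only [boxProd_adj, prismLeft, top_adj]
  rintro (⟨h, h'⟩ | ⟨h, rfl⟩)
  · exact hc v w h h'
  · exact h rfl

theorem not_prism_adj_right_right (v w : V) :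
    ¬ (G □ (⊤ : SimpleGraph (Fin 2))).Adj (prismRight c v) (prismRight c w) := by
  simp only [boxProd_adj, prismRight, top_adj]
  rintro (⟨h, h'⟩ | ⟨h, rfl⟩)
  · exact hc v w h (by simpa using h')
  · exact h rfl

theorem prism_subgraph_ext {M N : (G □ (⊤ : SimpleGraph (Fin 2))).Subgraph}
    (hM : M.IsSpanning) (hN : N.IsSpanning)
    (h : ∀ v w, M.Adj (prismLeft c v) (prismRight c w) ↔ N.Adj (prismLeft c v) (prismRight c w)) :
    M = N := by
  refine Subgraph.ext (by rw [hM.verts_eq_univ, hN.verts_eq_univ]) ?_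
  ext a b
  rcases eq_prismLeft_or_eq_prismRight c a with ⟨v, rfl⟩ | ⟨v, rfl⟩ <;>
    rcases eq_prismLeft_or_eq_prismRight c b with ⟨w, rfl⟩ | ⟨w, rfl⟩
  · exact iff_of_false (fun h' => not_prism_adj_left_left hc v w h'.adj_sub)
      (fun h' => not_prism_adj_left_left hc v w h'.adj_sub)
  · exact h v w
  · rw [M.adj_comm, N.adj_comm]; exact h w v
  · exact iff_of_false (fun h' => not_prism_adj_right_right hc v w h'.adj_sub)
      (fun h' => not_prism_adj_right_right hc v w h'.adj_sub)

theorem exists_perm_of_isPerfectMatching [Finite V]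
    {M : (G □ (⊤ : SimpleGraph (Fin 2))).Subgraph} (hM : M.IsPerfectMatching) :
    ∃ σ : Equiv.Perm V, ∀ v w, M.Adj (prismLeft c v) (prismRight c w) ↔ σ v = w := by
  rw [Subgraph.isPerfectMatching_iff] at hM
  have hex : ∀ v, ∃ w, M.Adj (prismLeft c v) (prismRight c w) := by
    intro v
    obtain ⟨b, hb, -⟩ := hM (prismLeft c v)
    rcases eq_prismLeft_or_eq_prismRight c b with ⟨w, rfl⟩ | ⟨w, rfl⟩
    · exact (not_prism_adj_left_left hc v w hb.adj_sub).elim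
    · exact ⟨w, hb⟩
  choose s hs using hex
  have hinj : Function.Injective s := fun u v huv =>
    prismLeft_injective ((hM (prismRight c (s u))).unique (hs u).symm (huv ▸ (hs v).symm))
  refine ⟨Equiv.ofBijective s (Finite.injective_iff_bijective.mp hinj), fun v w => ?_⟩
  constructor
  · exact fun h => prismRight_injective ((hM (prismLeft c v)).unique (hs v) h)
  · rintro rfl
    exact hs v

theorem exists_isPerfectMatching_of_perm (σ : Equiv.Perm V) (hσ : ∀ v, v = σ v ∨ G.Adj v (σ v)) :
    ∃ M : (G □ (⊤ : SimpleGraph (Fin 2))).Subgraph, M.IsPerfectMatching ∧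
      ∀ v w, M.Adj (prismLeft c v) (prismRight c w) ↔ σ v = w := by
  let M : (G □ (⊤ : SimpleGraph (Fin 2))).Subgraph :=
    { verts := Set.univ
      Adj := fun a b => ∃ v, (a = prismLeft c v ∧ b = prismRight c (σ v)) ∨
        (b = prismLeft c v ∧ a = prismRight c (σ v))
      adj_sub := by
        rintro a b ⟨v, ⟨rfl, rfl⟩ | ⟨rfl, rfl⟩⟩
        · exact (prism_adj_left_right hc _ _).mpr (hσ v)
        · exact ((prism_adj_left_right hc _ _).mpr (hσ v)).symm
      edge_vert := fun _ => Set.mem_univ _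
      symm := ⟨fun a b ⟨v, h⟩ => ⟨v, h.symm⟩⟩ }
  have hadj : ∀ v w, M.Adj (prismLeft c v) (prismRight c w) ↔ σ v = w := by
    intro v w
    constructor
    · rintro ⟨u, ⟨h1, h2⟩ | ⟨h1, h2⟩⟩
      · rw [prismLeft_injective h1, prismRight_injective h2]
      · exact (prismLeft_ne_prismRight _ _ h2).elim
    · rintro rfl
      exact ⟨v, .inl ⟨rfl, rfl⟩⟩
  refine ⟨M, ?_, hadj⟩
  rw [Subgraph.isPerfectMatching_iff]
  intro a
  rcases eq_prismLeft_or_eq_prismRight c a with ⟨v, rfl⟩ | ⟨w, rfl⟩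
  · refine ⟨prismRight c (σ v), (hadj _ _).mpr rfl, ?_⟩
    rintro b ⟨u, ⟨h1, h2⟩ | ⟨-, h2⟩⟩
    · rw [h2, prismLeft_injective h1]
    · exact (prismLeft_ne_prismRight _ _ h2).elim
  · refine ⟨prismLeft c (σ.symm w), Subgraph.Adj.symm ((hadj _ _).mpr (by simp)), ?_⟩
    rintro b ⟨u, ⟨h1, -⟩ | ⟨h1, h2⟩⟩
    · exact (prismLeft_ne_prismRight _ _ h1.symm).elim
    · rw [h1, prismRight_injective h2, Equiv.symm_apply_apply]

theorem card_le_rank_add_ncard_of_forcing {F : Type*} [Fintype V] [DecidableEq V] [Field F]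
    {N : Matrix V V F} (hN : ∀ v w, N v w ≠ 0 ↔ v = w ∨ G.Adj v w)
    {M : (G □ (⊤ : SimpleGraph (Fin 2))).Subgraph} (hM : M.IsPerfectMatching)
    {S : Set (Sym2 (V × Fin 2))} (hSM : S ⊆ M.edgeSet)
    (hS : ∀ M' : (G □ (⊤ : SimpleGraph (Fin 2))).Subgraph, M'.IsPerfectMatching →
      S ⊆ M'.edgeSet → M' = M) :
    Fintype.card V ≤ N.rank + S.ncard := by
  classical
  obtain ⟨σ, hσ⟩ := exists_perm_of_isPerfectMatching hc hM
  let T : Finset V := {v | s(prismLeft c v, prismRight c (σ v)) ∈ S}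
  have hT : T.card ≤ S.ncard := by
    rw [← Set.ncard_coe_finset]
    refine Set.ncard_le_ncard_of_injOn (fun v => s(prismLeft c v, prismRight c (σ v)))
      (fun v hv => by simpa [T] using hv) ?_ (Set.toFinite S)
    intro u _ v _ huv
    rcases Sym2.eq_iff.mp huv with ⟨h, -⟩ | ⟨h, -⟩
    · exact prismLeft_injective h
    · exact (prismLeft_ne_prismRight _ _ h).elim
  refine (N.card_le_rank_add_card_of_forced T σ ?_ ?_).trans (Nat.add_le_add_left hT _)
  · exact fun v => (hN _ _).mpr ((prism_adj_left_right hc _ _).mp ((hσ v _).mpr rfl).adj_sub)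
  · intro τ hτ hτσ
    obtain ⟨M', hM', hadj⟩ :=
      exists_isPerfectMatching_of_perm hc τ (fun v => (hN _ _).mp (hτ v))
    have key : ∀ v w, M.Adj (prismLeft c v) (prismRight c w) →
        s(prismLeft c v, prismRight c w) ∈ S → M'.Adj (prismLeft c v) (prismRight c w) := by
      intro v w hvw hmem
      obtain rfl := (hσ v w).mp hvw
      exact (hadj _ _).mpr (hτσ v (by simpa [T] using hmem))
    have hEq := hS M' hM' fun e he => by
      induction e with
      | _ a b =>
        have hab : M.Adj a b := hSM he
        show M'.Adj a b
        rcases eq_prismLeft_or_eq_prismRight c a with ⟨v, rfl⟩ | ⟨v, rfl⟩ <;>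
          rcases eq_prismLeft_or_eq_prismRight c b with ⟨w, rfl⟩ | ⟨w, rfl⟩
        · exact (not_prism_adj_left_left hc v w hab.adj_sub).elim
        · exact key v w hab he
        · exact (key w v hab.symm (Sym2.eq_swap ▸ he)).symm
        · exact (not_prism_adj_right_right hc v w hab.adj_sub).elim
    ext v
    exact (hadj v _).mp (hEq ▸ (hσ v _).mpr rfl)

theorem minForcingNumber_prism_le_card_color [Fintype V] (i : Fin 2) :
    minForcingNumber (G □ (⊤ : SimpleGraph (Fin 2))) ≤ Fintype.card {v // c v = i} := by
  obtain ⟨M, hM, hadj⟩ := exists_isPerfectMatching_of_perm hc 1 (fun v => .inl rfl)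
  let S : Set (Sym2 (V × Fin 2)) :=
    Set.range fun v : {v // c v = i} => s(prismLeft c v.1, prismRight c v.1)
  have hforce : forcingNumber (G □ (⊤ : SimpleGraph (Fin 2))) M ≤ S.ncard := by
    refine Nat.sInf_le ⟨S, ?_, rfl, fun M' hM' hS => ?_⟩
    · rintro _ ⟨v, rfl⟩
      exact (hadj _ _).mpr rfl
    · obtain ⟨σ, hσ⟩ := exists_perm_of_isPerfectMatching hc hM'
      have hfix : ∀ v, c v = i → σ v = v := fun v hv => (hσ v v).mp (hS ⟨⟨v, hv⟩, rfl⟩)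
      have hone : σ = 1 := by
        ext v
        rcases (prism_adj_left_right hc _ _).mp ((hσ v _).mpr rfl).adj_sub with h | h
        · exact h.symm
        · have h1 := hc _ _ h
          by_cases hv : c v = i
          · exact hfix v hv
          · exact σ.injective (hfix (σ v) (by omega))
      refine prism_subgraph_ext hc hM'.2 hM.2 fun v w => ?_
      rw [hσ, hadj, hone]
  calc minForcingNumber (G □ (⊤ : SimpleGraph (Fin 2)))
      ≤ forcingNumber (G □ (⊤ : SimpleGraph (Fin 2))) M := Nat.sInf_le ⟨M, hM, rfl⟩
    _ ≤ S.ncard := hforce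
    _ ≤ Fintype.card {v // c v = i} := by
      rw [← Nat.card_eq_fintype_card, ← Nat.card_coe_set_eq]
      exact Finite.card_range_le _

end Prism

theorem SimpleGraph.Subgraph.IsPerfectMatching.eq_of_edgeSet_subset {V : Type*}
    {G : SimpleGraph V} {M N : G.Subgraph} (hM : M.IsPerfectMatching) (hN : N.IsPerfectMatching)
    (h : M.edgeSet ⊆ N.edgeSet) : N = M := by
  refine Subgraph.ext (by rw [hM.2.verts_eq_univ, hN.2.verts_eq_univ]) ?_
  rw [Subgraph.isPerfectMatching_iff] at hM hN
  have hle : ∀ a b, M.Adj a b → N.Adj a b := fun a b hab => h (show s(a, b) ∈ M.edgeSet from hab)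
  ext a b
  refine ⟨fun hab => ?_, hle a b⟩
  obtain ⟨b', hb', -⟩ := hM a
  rwa [(hN a).unique hab (hle a b' hb')]

theorem exists_minForcingNumber_eq_ncard {V : Type*} {G : SimpleGraph V}
    (hG : ∃ M : G.Subgraph, M.IsPerfectMatching) :
    ∃ M : G.Subgraph, M.IsPerfectMatching ∧ ∃ S : Set (Sym2 V), S ⊆ M.edgeSet ∧
      S.ncard = minForcingNumber G ∧
      ∀ M' : G.Subgraph, M'.IsPerfectMatching → S ⊆ M'.edgeSet → M' = M := by
  obtain ⟨M₀, hM₀⟩ := hG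
  obtain ⟨M, hM, hMf⟩ := Nat.sInf_mem
    (s := {c | ∃ M : G.Subgraph, M.IsPerfectMatching ∧ forcingNumber G M = c}) ⟨_, M₀, hM₀, rfl⟩
  obtain ⟨S, hSM, hcard, hS⟩ := Nat.sInf_mem
    (s := {c | ∃ S : Set (Sym2 V), S ⊆ M.edgeSet ∧ S.ncard = c ∧
      ∀ M' : G.Subgraph, M'.IsPerfectMatching → S ⊆ M'.edgeSet → M' = M})
    ⟨_, M.edgeSet, subset_rfl, rfl, fun M' hM' h => hM.eq_of_edgeSet_subset hM' h⟩
  exact ⟨M, hM, S, hSM, hcard.trans hMf, hS⟩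

theorem stmt4 {V F : Type*} [Fintype V] [DecidableEq V] [Field F]
    (G : SimpleGraph V)
    (hbip : ∃ c : V → Bool, ∀ u v, G.Adj u v → c u ≠ c v)
    (A : Matrix V V F) (hA : ∀ u v, A u v ≠ 0 ↔ G.Adj u v)
    (hinv : A * A = 1) :
    (minForcingNumber (G □ (⊤ : SimpleGraph (Fin 2))) : ℝ) = (Fintype.card V : ℝ) / 2 := by
  obtain ⟨c, hc⟩ : ∃ c : V → Fin 2, ∀ u v, G.Adj u v → c u ≠ c v := by
    obtain ⟨c, hc⟩ := hbip
    exact ⟨fun v => finTwoEquiv.symm (c v), fun u v h => finTwoEquiv.symm.injective.ne (hc u v h)⟩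
  have hN : ∀ v w, (A + 1) v w ≠ 0 ↔ v = w ∨ G.Adj v w := by
    intro v w
    by_cases hvw : v = w
    · subst hvw
      have h0 : A v v = 0 := by
        by_contra h
        exact G.irrefl ((hA v v).mp h)
      simp [h0]
    · simp [hvw, ← hA]
  obtain ⟨M₀, hM₀, -⟩ := exists_isPerfectMatching_of_perm hc 1 (fun v => .inl rfl)
  obtain ⟨M, hM, S, hSM, hcard, hS⟩ := exists_minForcingNumber_eq_ncard ⟨M₀, hM₀⟩
  have hlower := card_le_rank_add_ncard_of_forcing hc hN hM hSM hS
  have hrank := A.two_mul_rank_add_one_le c (fun u v h => hc u v ((hA u v).mp h)) hinv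
  have h0 := minForcingNumber_prism_le_card_color hc 0
  have h1 := minForcingNumber_prism_le_card_color hc 1
  have hsum : Fintype.card {v // c v = 0} + Fintype.card {v // c v = 1} = Fintype.card V := by
    rw [← Fintype.card_congr (Equiv.sigmaFiberEquiv c), Fintype.card_sigma, Fin.sum_univ_two]
  have heq : 2 * minForcingNumber (G □ (⊤ : SimpleGraph (Fin 2))) = Fintype.card V := by omega
  rw [← heq]
  push_cast
  ring
end

section
/- Let F be a field with |F| ≥ 4 and let G be a finite simple bipartite graph that admits an involutory weighted adjacency matrix over F. Then for every positive integer d, f(G □ Q_d) = 2^{d-2}·|V(G)|. -/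
open SimpleGraph

def hypercube (d : ℕ) : SimpleGraph (Fin d → Bool) :=
  SimpleGraph.fromRel (fun u v => (Finset.univ.filter (fun i => u i ≠ v i)).card = 1)

open scoped Kronecker

theorem SimpleGraph.Subgraph.IsPerfectMatching.eq_of_adj {W : Type*} {K : SimpleGraph W}
    {M M' : K.Subgraph} (hM : M.IsPerfectMatching) (hM' : M'.IsPerfectMatching)
    (h : ∀ v w, M.Adj v w → M'.Adj v w) : M' = M := by
  refine Subgraph.ext ?_ ?_
  · rw [hM.2.verts_eq_univ, hM'.2.verts_eq_univ]
  · ext v w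
    refine ⟨fun hvw => ?_, h v w⟩
    obtain ⟨x, hx, -⟩ := Subgraph.isPerfectMatching_iff.1 hM v
    rwa [(Subgraph.isPerfectMatching_iff.1 hM' v).unique hvw (h v x hx)]

theorem minForcingNumber_le_ncard {W : Type*} {K : SimpleGraph W} {M : K.Subgraph}
    (hM : M.IsPerfectMatching) {S : Set (Sym2 W)} (hS : S ⊆ M.edgeSet)
    (hforce : ∀ M' : K.Subgraph, M'.IsPerfectMatching → S ⊆ M'.edgeSet → M' = M) :
    minForcingNumber K ≤ S.ncard := by
  refine le_trans (b := forcingNumber K M) ?_ ?_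
  · exact Nat.sInf_le ⟨M, hM, rfl⟩
  · exact Nat.sInf_le ⟨S, hS, rfl, hforce⟩

theorem exists_ncard_eq_minForcingNumber {W : Type*} {K : SimpleGraph W}
    (hK : ∃ M : K.Subgraph, M.IsPerfectMatching) :
    ∃ M : K.Subgraph, M.IsPerfectMatching ∧ ∃ S : Set (Sym2 W), S ⊆ M.edgeSet ∧
      S.ncard = minForcingNumber K ∧
      ∀ M' : K.Subgraph, M'.IsPerfectMatching → S ⊆ M'.edgeSet → M' = M := by
  obtain ⟨M₀, hM₀⟩ := hK
  obtain ⟨M, hM, hmin⟩ := Nat.sInf_mem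
    (s := {c | ∃ M : K.Subgraph, M.IsPerfectMatching ∧ forcingNumber K M = c}) ⟨_, M₀, hM₀, rfl⟩
  obtain ⟨S, hS, hcard, hforce⟩ := Nat.sInf_mem
    (s := {c | ∃ S : Set (Sym2 W), S ⊆ M.edgeSet ∧ S.ncard = c ∧
      ∀ M' : K.Subgraph, M'.IsPerfectMatching → S ⊆ M'.edgeSet → M' = M})
    ⟨_, M.edgeSet, subset_rfl, rfl, fun M' hM' h => hM.eq_of_adj hM' fun v w hvw =>
      Subgraph.mem_edgeSet.1 (h (Subgraph.mem_edgeSet.2 hvw))⟩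
  exact ⟨M, hM, S, hS, hcard.trans hmin, hforce⟩

/-- The spanning subgraph joining every vertex to its image under an involution along edges. -/
def matchingOfInvolution {W : Type*} {K : SimpleGraph W} (τ : W → W)
    (hτ : Function.Involutive τ) (hadj : ∀ v, K.Adj v (τ v)) : K.Subgraph where
  verts := Set.univ
  Adj v w := τ v = w
  adj_sub := by rintro v w rfl; exact hadj v
  edge_vert _ := Set.mem_univ _
  symm := ⟨by rintro v w rfl; exact hτ v⟩

theorem matchingOfInvolution_isPerfectMatching {W : Type*} {K : SimpleGraph W} (τ : W → W)
    (hτ : Function.Involutive τ) (hadj : ∀ v, K.Adj v (τ v)) :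
    (matchingOfInvolution τ hτ hadj).IsPerfectMatching :=
  Subgraph.isPerfectMatching_iff.2 fun v => ⟨τ v, rfl, fun _ h => Eq.symm h⟩

theorem SimpleGraph.Subgraph.IsPerfectMatching.exists_involution {W : Type*} {K : SimpleGraph W}
    {M : K.Subgraph} (hM : M.IsPerfectMatching) :
    ∃ τ : W → W, Function.Involutive τ ∧ ∀ v w, M.Adj v w ↔ τ v = w := by
  choose τ hτ huniq using Subgraph.isPerfectMatching_iff.1 hM
  refine ⟨τ, fun v => (huniq _ _ (hτ v).symm).symm, fun v w => ⟨fun h => (huniq _ _ h).symm, ?_⟩⟩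
  rintro rfl
  exact hτ v

/-- In a bipartite graph, a permutation along edges which agrees with a perfect matching at the
endpoints of a forcing set is the perfect matching itself. -/
theorem perm_eq_of_forcing {W : Type*} {K : SimpleGraph W}
    {c : W → Bool} (hc : ∀ u v, K.Adj u v → c u ≠ c v)
    {M : K.Subgraph} {S : Set (Sym2 W)} (hS : S ⊆ M.edgeSet)
    (hforce : ∀ M' : K.Subgraph, M'.IsPerfectMatching → S ⊆ M'.edgeSet → M' = M)
    {τ : W → W} (hτ : Function.Involutive τ) (hM : ∀ v w, M.Adj v w ↔ τ v = w)
    (σ : Equiv.Perm W) (hσ : ∀ v, K.Adj v (σ v)) (hσS : ∀ v, s(v, τ v) ∈ S → σ v = τ v)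
    (b : Bool) (v : W) (hv : c v = b) : σ v = τ v := by
  let ρ : W → W := fun v => if c v = b then σ v else σ.symm v
  have hρpos : ∀ v, c v = b → ρ v = σ v := fun v hv => if_pos hv
  have hρneg : ∀ v, c v ≠ b → ρ v = σ.symm v := fun v hv => if_neg hv
  have hadj' : ∀ v, K.Adj v (σ.symm v) := fun v => by simpa using (hσ (σ.symm v)).symm
  have hρadj : ∀ v, K.Adj v (ρ v) := by
    intro v
    by_cases h : c v = b
    · rw [hρpos v h]; exact hσ v
    · rw [hρneg v h]; exact hadj' v
  have hρ : Function.Involutive ρ := by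
    intro v
    by_cases h : c v = b
    · rw [hρpos v h, hρneg _ (h ▸ (hc _ _ (hσ v)).symm), Equiv.symm_apply_apply]
    · have h' : c (σ.symm v) = b := by
        have hbool : ∀ x y b : Bool, x ≠ b → x ≠ y → y = b := by decide
        exact hbool _ _ _ h (hc _ _ (hadj' v))
      rw [hρneg v h, hρpos _ h', Equiv.apply_symm_apply]
  have key := hforce _ (matchingOfInvolution_isPerfectMatching ρ hρ hρadj) (by
    intro e he
    have heM := hS he
    induction e using Sym2.ind with
    | _ u w =>
    rw [Subgraph.mem_edgeSet, hM] at heM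
    subst heM
    change ρ u = τ u
    by_cases h : c u = b
    · rw [hρpos u h, hσS u he]
    · have : σ (τ u) = u := by
        rw [hσS (τ u) (by rwa [hτ u, Sym2.eq_swap]), hτ u]
      rw [hρneg u h, Equiv.symm_apply_eq, this])
  have : M.Adj v (σ v) := by
    rw [← key]
    exact hρpos v hv
  exact ((hM _ _).1 this).symm

theorem card_le_four_mul_ncard_of_forcing {W F : Type*} [Fintype W] [DecidableEq W] [Field F]
    {K : SimpleGraph W} {c : W → Bool} (hc : ∀ u v, K.Adj u v → c u ≠ c v)
    {A : Matrix W W F} (hA : ∀ u v, A u v ≠ 0 ↔ K.Adj u v) (hA2 : A * A = 0)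
    {M : K.Subgraph} (hM : M.IsPerfectMatching) {S : Set (Sym2 W)} (hS : S ⊆ M.edgeSet)
    (hforce : ∀ M' : K.Subgraph, M'.IsPerfectMatching → S ⊆ M'.edgeSet → M' = M) :
    Fintype.card W ≤ 4 * S.ncard := by
  classical
  obtain ⟨τ, hτ, hMτ⟩ := hM.exists_involution
  have hτadj : ∀ v, K.Adj v (τ v) := fun v => M.adj_sub ((hMτ _ _).2 rfl)
  let T : Finset W := {v | s(v, τ v) ∉ S}
  let B : Matrix W W F :=
    Matrix.of fun u v => if v ∈ T then A u v else if u = τ v then 1 else 0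
  have hBT : ∀ u v, v ∈ T → B u v = A u v := fun u v hv => if_pos hv
  have hBS : ∀ u v, v ∉ T → B u v = if u = τ v then 1 else 0 := fun u v hv => if_neg hv
  have hB : ∀ u v, B u v ≠ 0 → K.Adj v u ∧ (s(v, τ v) ∈ S → u = τ v) := by
    intro u v h
    by_cases hv : v ∈ T
    · rw [hBT u v hv] at h
      exact ⟨((hA _ _).1 h).symm, fun h' => absurd h' (by simpa [T] using hv)⟩
    · simp only [hBS u v hv, ne_eq, ite_eq_right_iff, Classical.not_imp] at h
      obtain rfl := h.1
      exact ⟨hτadj v, fun _ => rfl⟩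
  have hdet : B.det ≠ 0 := by
    rw [Matrix.det_apply', Finset.sum_eq_single hτ.toPerm]
    · refine mul_ne_zero ?_ (Finset.prod_ne_zero_iff.2 fun v _ => ?_)
      · rcases Int.units_eq_one_or (Equiv.Perm.sign hτ.toPerm) with h | h <;> simp [h]
      · by_cases hv : v ∈ T
        · rw [hBT _ v hv]
          exact (hA _ _).2 (hτadj v).symm
        · simp [hBS _ v hv]
    · intro σ _ hne
      by_contra h
      have h0 : ∀ v, B (σ v) v ≠ 0 := fun v hv =>
        h (mul_eq_zero_of_right _ (Finset.prod_eq_zero (Finset.mem_univ v) hv))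
      refine hne (Equiv.ext fun v => ?_)
      exact perm_eq_of_forcing hc hS hforce hτ hMτ σ (fun v => (hB _ _ (h0 v)).1)
        (fun v => (hB _ _ (h0 v)).2) (c v) v rfl
    · simp
  have hrank : T.card ≤ A.rank := by
    have hli : LinearIndependent F (fun v : T => A.col v) := by
      have := (Matrix.linearIndependent_cols_of_det_ne_zero hdet).comp
        (fun v : T => (v : W)) Subtype.val_injective
      exact (funext fun v => funext fun u => (hBT u v v.2).symm :
        (fun v : T => A.col v) = B.col ∘ fun v : T => (v : W)) ▸ this
    rw [Matrix.rank_eq_finrank_span_cols, ← Fintype.card_coe, ← finrank_span_eq_card hli]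
    exact Submodule.finrank_mono (Submodule.span_mono (by rintro _ ⟨v, rfl⟩; exact ⟨v, rfl⟩))
  have hhalf := Matrix.rank_add_rank_le_card_of_mul_eq_zero hA2
  have hcompl : Tᶜ.card ≤ 2 * S.ncard := by
    rw [Set.ncard_eq_toFinset_card']
    refine Finset.card_le_mul_card_image_of_maps_to (f := fun v => s(v, τ v))
      (fun v hv => by simpa [T] using hv) 2 fun e _ => ?_
    induction e using Sym2.ind with
    | _ x y =>
    refine (Finset.card_le_card (t := {x, y}) fun v hv => ?_).trans Finset.card_le_two
    have := (Finset.mem_filter.1 hv).2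
    have hmem : v ∈ s(x, y) := this ▸ Sym2.mem_mk_left _ _
    simpa using hmem
  have := T.card_add_card_compl
  omega

/-- If a perfect matching is compatible with a labelling whose label classes only contain
edges of the matching, then the matching edges of either label force it. -/
theorem four_mul_minForcingNumber_le {W : Type*} [Fintype W] {K : SimpleGraph W} {τ : W → W}
    (hτ : Function.Involutive τ) (hadj : ∀ v, K.Adj v (τ v)) {p : W → Bool}
    (hp : ∀ v, p (τ v) = p v) (hK : ∀ u v, K.Adj u v → p u = p v → τ u = v) :
    4 * minForcingNumber K ≤ Fintype.card W := by
  classical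
  have key : ∀ b : Bool, 2 * minForcingNumber K ≤ (Finset.univ.filter (p · = b)).card := by
    intro b
    let S : Finset (Sym2 W) := (Finset.univ.filter (p · = b)).image fun v => s(v, τ v)
    have hS : 2 * S.card ≤ (Finset.univ.filter (p · = b)).card := by
      refine Finset.mul_card_image_le_card _ 2 fun e he => ?_
      obtain ⟨v, hv, rfl⟩ := Finset.mem_image.1 he
      rw [← Finset.card_pair (hadj v).ne]
      refine Finset.card_le_card fun w hw => ?_
      have hv' : p v = b := by simpa using hv
      rcases Finset.mem_insert.1 hw with rfl | hw
      · simp [hv']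
      · rw [Finset.mem_singleton.1 hw]
        simp [hv', hp, hτ v]
    have hle : minForcingNumber K ≤ (S : Set (Sym2 W)).ncard := by
      refine minForcingNumber_le_ncard (matchingOfInvolution_isPerfectMatching τ hτ hadj) ?_ ?_
      · intro e he
        obtain ⟨v, -, rfl⟩ := Finset.mem_image.1 (Finset.mem_coe.1 he)
        exact Subgraph.mem_edgeSet.2 rfl
      · intro M' hM' hSM
        refine (matchingOfInvolution_isPerfectMatching τ hτ hadj).eq_of_adj hM' ?_
        have hb : ∀ v, p v = b → M'.Adj v (τ v) := fun v hv =>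
          Subgraph.mem_edgeSet.1 (hSM (Finset.mem_coe.2
            (Finset.mem_image_of_mem _ (by simpa using hv))))
        rintro v _ rfl
        by_cases hv : p v = b
        · exact hb v hv
        · obtain ⟨w, hw, -⟩ := Subgraph.isPerfectMatching_iff.1 hM' v
          have hwb : p w ≠ b := by
            intro h
            have := (Subgraph.isPerfectMatching_iff.1 hM' w).unique hw.symm (hb w h)
            exact hv (by rw [this, hp, h])
          have hbool : ∀ x y b : Bool, x ≠ b → y ≠ b → x = y := by decide
          have hvw : p v = p w := hbool _ _ _ hv hwb
          rwa [hK v w (M'.adj_sub hw) hvw]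
    rw [Set.ncard_coe_finset] at hle
    omega
  have hsum := Finset.card_filter_add_card_filter_not (s := (Finset.univ : Finset W)) (p · = true)
  simp only [Bool.not_eq_true] at hsum
  have h1 := key true
  have h2 := key false
  rw [← Finset.card_univ]
  omega

/-- `A` is a weighted adjacency matrix of `K` whose square is the scalar matrix `t`. -/
def IsScalarSquareWeighting {W F : Type*} [Fintype W] [DecidableEq W] [Field F]
    (K : SimpleGraph W) (A : Matrix W W F) (t : F) : Prop :=
  (∀ u v, A u v ≠ 0 ↔ K.Adj u v) ∧ A * A = t • (1 : Matrix W W F)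

theorem IsScalarSquareWeighting.submatrix {W W' F : Type*} [Fintype W] [DecidableEq W]
    [Fintype W'] [DecidableEq W'] [Field F] {K : SimpleGraph W} {K' : SimpleGraph W'}
    {A : Matrix W W F} {t : F} (h : IsScalarSquareWeighting K A t) (e : K' ≃g K) :
    IsScalarSquareWeighting K' (A.submatrix e e) t := by
  refine ⟨fun u v => (h.1 _ _).trans e.map_adj_iff, ?_⟩
  have := Matrix.submatrix_mul_equiv A A e e.toEquiv e
  rw [h.2] at this
  refine this.trans ?_
  ext i j
  simp [Matrix.one_apply]

theorem IsScalarSquareWeighting.boxProd_bool {W F : Type*} [Fintype W] [DecidableEq W] [Field F]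
    {K : SimpleGraph W} {A : Matrix W W F} (h : IsScalarSquareWeighting K A 1)
    {a s : F} (ha : a ≠ 0) (hs : s ≠ 0) :
    ∃ A' : Matrix (W × Bool) (W × Bool) F,
      IsScalarSquareWeighting (K □ (⊤ : SimpleGraph Bool)) A' (a * a + s) := by
  let D : Matrix Bool Bool F := Matrix.of fun i j => if i = j then (if i then a else -a) else 0
  let J : Matrix Bool Bool F := Matrix.of fun i j => if i = j then 0 else (if i then 1 else s)
  have hDD : D * D = (a * a) • (1 : Matrix Bool Bool F) := by
    ext i j; cases i <;> cases j <;> simp [D, Matrix.mul_apply]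
  have hJJ : J * J = s • (1 : Matrix Bool Bool F) := by
    ext i j; cases i <;> cases j <;> simp [J, Matrix.mul_apply]
  have hDJ : D * J + J * D = 0 := by
    ext i j; cases i <;> cases j <;> simp [D, J, Matrix.mul_apply, mul_comm]
  refine ⟨A ⊗ₖ D + (1 : Matrix W W F) ⊗ₖ J, ?_, ?_⟩
  · rintro ⟨u, i⟩ ⟨v, j⟩
    have hA := h.1 u v
    by_cases huv : u = v
    · subst huv
      have hA0 : A u u = 0 := by simpa using hA
      cases i <;> cases j <;> simp [D, J, Matrix.kroneckerMap_apply, hA0, hs, boxProd_adj]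
    · cases i <;> cases j <;>
        simp [D, J, Matrix.kroneckerMap_apply, ha, ← hA, huv, boxProd_adj]
  · rw [add_mul, mul_add, mul_add, ← Matrix.mul_kronecker_mul, ← Matrix.mul_kronecker_mul,
      ← Matrix.mul_kronecker_mul, ← Matrix.mul_kronecker_mul, h.2, hDD, hJJ]
    simp only [mul_one, one_mul, one_smul]
    have : A ⊗ₖ (D * J) + A ⊗ₖ (J * D) = 0 := by
      rw [← Matrix.kronecker_add, hDJ, Matrix.kronecker_zero]
    rw [Matrix.kronecker_smul, Matrix.kronecker_smul, Matrix.one_kronecker_one, add_smul,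
      add_assoc, ← add_assoc (A ⊗ₖ (D * J)), this, zero_add]

theorem hypercube_adj {d : ℕ} {x y : Fin d → Bool} :
    (hypercube d).Adj x y ↔ (Finset.univ.filter fun i => x i ≠ y i).card = 1 := by
  simp only [hypercube, fromRel_adj, ne_comm (a := y _), or_self]
  refine and_iff_right_of_imp ?_
  rintro h rfl
  simp at h

theorem hypercube_succ_adj {d : ℕ} {x y : Fin (d + 1) → Bool} :
    (hypercube (d + 1)).Adj x y ↔
      ((hypercube d).Adj (Fin.tail x) (Fin.tail y) ∧ x 0 = y 0) ∨
        (x 0 ≠ y 0 ∧ Fin.tail x = Fin.tail y) := by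
  simp only [hypercube_adj, Fin.card_filter_univ_succ, Fin.tail, funext_iff]
  by_cases h : x 0 = y 0
  · simp only [h, if_false, and_true, not_true_eq_false, ne_eq, false_and, or_false]
    congr!
  · simp [h, Finset.filter_eq_empty_iff]

/-- Splitting off the first coordinate of the hypercube. -/
def boxProdHypercubeSuccIso {V : Type*} (G : SimpleGraph V) (d : ℕ) :
    SimpleGraph.Iso (G □ hypercube (d + 1)) ((G □ hypercube d) □ (⊤ : SimpleGraph Bool)) where
  toFun v := ((v.1, Fin.tail v.2), v.2 0)
  invFun v := (v.1.1, Fin.cons v.2 v.1.2)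
  left_inv v := by simp
  right_inv v := by simp
  map_rel_iff' := by
    rintro ⟨u, x⟩ ⟨v, y⟩
    have hxy : x = y ↔ x 0 = y 0 ∧ Fin.tail x = Fin.tail y := by
      simp [funext_iff, Fin.forall_fin_succ, Fin.tail]
    simp only [Equiv.coe_fn_mk, boxProd_adj, hypercube_succ_adj, top_adj, hxy, Prod.mk.injEq]
    tauto

/-- The zero-dimensional hypercube is a single vertex. -/
def boxProdHypercubeZeroIso {V : Type*} (G : SimpleGraph V) :
    SimpleGraph.Iso (G □ hypercube 0) G where
  toEquiv := Equiv.prodUnique V (Fin 0 → Bool)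
  map_rel_iff' := by
    rintro ⟨u, x⟩ ⟨v, y⟩
    simp [boxProd_adj, Subsingleton.elim x y]

theorem exists_bool_coloring_boxProd_hypercube {V : Type*} {G : SimpleGraph V}
    (hG : ∃ c : V → Bool, ∀ u v, G.Adj u v → c u ≠ c v) (d : ℕ) :
    ∃ c : V × (Fin d → Bool) → Bool, ∀ u v, (G □ hypercube d).Adj u v → c u ≠ c v := by
  induction d with
  | zero =>
    obtain ⟨c, hc⟩ := hG
    exact ⟨c ∘ boxProdHypercubeZeroIso G, fun u v h =>
      hc _ _ ((boxProdHypercubeZeroIso G).map_adj_iff.2 h)⟩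
  | succ d ih =>
    obtain ⟨c, hc⟩ := ih
    let e := boxProdHypercubeSuccIso G d
    refine ⟨fun v => (c (e v).1).xor (e v).2, fun u v h => ?_⟩
    rcases boxProd_adj.1 (e.map_adj_iff.2 h) with ⟨h1, h2⟩ | ⟨h1, h2⟩
    · simpa [h2] using hc _ _ h1
    · simpa [h2] using h1

theorem exists_involutory_boxProd_hypercube {V F : Type*} [Fintype V] [DecidableEq V] [Field F]
    (hF : 4 ≤ Cardinal.mk F) {G : SimpleGraph V} {A : Matrix V V F}
    (hA : IsScalarSquareWeighting G A 1) (d : ℕ) :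
    ∃ A' : Matrix (V × (Fin d → Bool)) (V × (Fin d → Bool)) F,
      IsScalarSquareWeighting (G □ hypercube d) A' 1 := by
  induction d with
  | zero => exact ⟨_, hA.submatrix (boxProdHypercubeZeroIso G)⟩
  | succ d ih =>
    obtain ⟨A₀, hA₀⟩ := ih
    obtain ⟨a, ha⟩ := Cardinal.exists_notMem_of_length_lt [0, 1, (-1 : F)]
      (lt_of_lt_of_le (by norm_num) hF)
    simp only [List.mem_cons, List.not_mem_nil, or_false, not_or] at ha
    have hs : 1 - a * a ≠ 0 := fun h =>
      (mul_self_eq_one_iff.1 (sub_eq_zero.1 h).symm).elim ha.2.1 ha.2.2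
    obtain ⟨A₁, hA₁⟩ := hA₀.boxProd_bool ha.1 hs
    rw [add_sub_cancel] at hA₁
    exact ⟨_, hA₁.submatrix (boxProdHypercubeSuccIso G d)⟩

theorem stmt9 {V F : Type*} [Fintype V] [DecidableEq V] [Field F]
    (hF : 4 ≤ Cardinal.mk F)
    (G : SimpleGraph V)
    (hbip : ∃ c : V → Bool, ∀ u v, G.Adj u v → c u ≠ c v)
    (A : Matrix V V F) (hA : ∀ u v, A u v ≠ 0 ↔ G.Adj u v)
    (hinv : A * A = 1)
    (d : ℕ) (hd : 1 ≤ d) :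
    (minForcingNumber (G □ hypercube d) : ℝ)
      = (2 : ℝ) ^ ((d : ℤ) - 2) * (Fintype.card V : ℝ) := by
  obtain ⟨d, rfl⟩ := Nat.exists_eq_add_of_le' hd
  let e := boxProdHypercubeSuccIso G d
  obtain ⟨A₀, hA₀⟩ := exists_involutory_boxProd_hypercube hF ⟨hA, by rw [hinv, one_smul]⟩ d
  obtain ⟨A₁, hA₁⟩ := hA₀.boxProd_bool one_ne_zero (neg_ne_zero.2 one_ne_zero)
  obtain ⟨hA₂, hsq⟩ := hA₁.submatrix e
  rw [mul_one, add_neg_cancel, zero_smul] at hsq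
  obtain ⟨c, hc⟩ := exists_bool_coloring_boxProd_hypercube hbip (d + 1)
  obtain ⟨p, hp⟩ := exists_bool_coloring_boxProd_hypercube hbip d
  let τ : V × (Fin (d + 1) → Bool) → V × (Fin (d + 1) → Bool) :=
    fun v => e.symm ((e v).1, !(e v).2)
  have hτ : Function.Involutive τ := fun v => by simp [τ]
  have hadj : ∀ v, (G □ hypercube (d + 1)).Adj v (τ v) := fun v => by
    rw [← e.map_adj_iff]
    simp [τ, boxProd_adj]
  have hle := four_mul_minForcingNumber_le hτ hadj (p := fun v => p (e v).1)
    (fun v => by simp [τ]) (fun u v huv hpuv => by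
      rcases boxProd_adj.1 (e.map_adj_iff.2 huv) with ⟨h, -⟩ | ⟨h, h'⟩
      · exact absurd hpuv (hp _ _ h)
      · rw [← e.symm_apply_apply v]
        exact congrArg e.symm (Prod.ext h' (Bool.eq_not.2 h.symm).symm))
  obtain ⟨M, hM, S, hS, hcard, hforce⟩ := exists_ncard_eq_minForcingNumber
    ⟨_, matchingOfInvolution_isPerfectMatching τ hτ hadj⟩
  have hge := card_le_four_mul_ncard_of_forcing hc hA₂ hsq hM hS hforce
  rw [hcard] at hge
  have heq := le_antisymm hle hge
  rw [Fintype.card_prod, Fintype.card_fun, Fintype.card_bool, Fintype.card_fin] at heq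
  have heq' : (4 : ℝ) * minForcingNumber (G □ hypercube (d + 1)) =
      Fintype.card V * 2 ^ (d + 1) := by exact_mod_cast heq
  rw [zpow_sub₀ two_ne_zero, zpow_natCast]
  norm_num
  linarith
end
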